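/- If f is a normalized analytic function on the unit disk 𝔻 that is injective on 𝔻 and odd, i.e. f(-z) = -f(z) for all z ∈ 𝔻, then for every n ≥ 2 the n-th partial sum f_n is injective on the disk {z : |z| < 1/√3}. -/

import Mathlib

open Complex Metric Finset

theorem hasFPowerSeriesOnBall_ofScalars_of_hasSum {a : ℕ → ℂ} {f : ℂ → ℂ}
    (hf : ∀ z ∈ ball (0:ℂ) 1, HasSum (fun k => a k * z ^ k) (f z)) :
    HasFPowerSeriesOnBall f (FormalMultilinearSeries.ofScalars ℂ a) 0 1 where
  r_le := by
    refine ENNReal.le_of_forall_nnreal_lt fun r hr => ?_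
    have hr' : ((r : ℝ) : ℂ) ∈ ball (0:ℂ) 1 := by
      simpa using hr
    apply FormalMultilinearSeries.le_radius_of_summable_norm
    simpa using (hf _ hr').summable.norm
  r_pos := one_pos
  hasSum := by
    intro y hy
    have hy' : y ∈ ball (0:ℂ) 1 := by
      rwa [← Metric.eball_ofReal, ENNReal.ofReal_one]
    simpa [FormalMultilinearSeries.ofScalars_apply_eq, mul_comm] using hf y hy'

theorem coeff_eq_of_hasSum {a b : ℕ → ℂ} {f : ℂ → ℂ}
    (ha : ∀ z ∈ ball (0:ℂ) 1, HasSum (fun k => a k * z ^ k) (f z))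
    (hb : ∀ z ∈ ball (0:ℂ) 1, HasSum (fun k => b k * z ^ k) (f z)) : a = b :=
  FormalMultilinearSeries.ofScalars_series_injective (𝕜 := ℂ) ℂ
    ((hasFPowerSeriesOnBall_ofScalars_of_hasSum ha).hasFPowerSeriesAt.eq_formalMultilinearSeries
      (hasFPowerSeriesOnBall_ofScalars_of_hasSum hb).hasFPowerSeriesAt)

theorem differentiableOn_of_hasSum {a : ℕ → ℂ} {f : ℂ → ℂ}
    (hf : ∀ z ∈ ball (0:ℂ) 1, HasSum (fun k => a k * z ^ k) (f z)) :
    DifferentiableOn ℂ f (ball 0 1) := by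
  simpa [← ENNReal.ofReal_one, Metric.eball_ofReal] using
    (hasFPowerSeriesOnBall_ofScalars_of_hasSum hf).differentiableOn

theorem exists_hasSum_of_differentiableOn {f : ℂ → ℂ} (hf : DifferentiableOn ℂ f (ball 0 1)) :
    ∃ a : ℕ → ℂ, ∀ z ∈ ball (0:ℂ) 1, HasSum (fun k => a k * z ^ k) (f z) := by
  refine ⟨fun k => (k.factorial : ℂ)⁻¹ * iteratedDeriv k f 0, fun z hz => ?_⟩
  have := Complex.hasSum_taylorSeries_on_ball (r := 1) (by simpa using hf) (z := z) (by simpa using hz)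
  simpa [mul_assoc, mul_comm, mul_left_comm] using this

theorem hasSum_deriv_of_hasSum {a : ℕ → ℂ} {f : ℂ → ℂ}
    (hf : ∀ z ∈ ball (0:ℂ) 1, HasSum (fun k => a k * z ^ k) (f z)) {z : ℂ}
    (hz : z ∈ ball (0:ℂ) 1) :
    HasSum (fun k => (k + 1) * a (k + 1) * z ^ k) (deriv f z) := by
  have hd := differentiableOn_of_hasSum hf
  have key : a = fun k => (k.factorial : ℂ)⁻¹ * iteratedDeriv k f 0 := by
    refine coeff_eq_of_hasSum hf fun z hz => ?_
    have := Complex.hasSum_taylorSeries_on_ball (r := 1) (by simpa using hd) (z := z) (by simpa using hz)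
    simpa [mul_assoc, mul_comm, mul_left_comm] using this
  have := Complex.hasSum_taylorSeries_on_ball (r := 1)
    (by simpa using hd.deriv isOpen_ball) (z := z) (by simpa using hz)
  refine this.congr_fun fun k => ?_
  have hk : (k.factorial : ℂ) ≠ 0 := by exact_mod_cast k.factorial_ne_zero
  have hk' : (k + 1 : ℂ) ≠ 0 := by exact_mod_cast k.succ_ne_zero
  rw [key, ← iteratedDeriv_succ']
  simp only [Nat.factorial_succ, smul_eq_mul, sub_zero, Nat.cast_mul, Nat.cast_add, Nat.cast_one]
  field_simp

theorem continuous_of_hasSum_exp {q : ℕ → ℂ} {F : ℝ → ℂ} (hq : Summable fun k => ‖q k‖)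
    (hF : ∀ θ : ℝ, HasSum (fun k => q k * exp (k * θ * I)) (F θ)) : Continuous F := by
  have : F = fun θ : ℝ => ∑' k, q k * exp (k * θ * I) := funext fun θ => (hF θ).tsum_eq.symm
  rw [this]
  refine continuous_tsum (fun k => by fun_prop) hq fun k θ => ?_
  rw [norm_mul, ← ofReal_natCast, ← ofReal_mul, norm_exp_ofReal_mul_I, mul_one]

theorem integral_exp_natCast_sub (k m : ℕ) :
    ∫ θ in -Real.pi..Real.pi, exp (k * θ * I) * exp (-(m * θ * I)) =
      if k = m then (2 * Real.pi : ℂ) else 0 := by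
  split_ifs with h
  · subst h
    simp [← Complex.exp_add, two_mul]
  · have hc : ((k : ℂ) - m) * I ≠ 0 := by
      refine mul_ne_zero (sub_ne_zero.2 ?_) I_ne_zero
      exact_mod_cast h
    have : ∀ θ : ℝ, exp (k * θ * I) * exp (-(m * θ * I)) = exp (((k : ℂ) - m) * I * θ) := by
      intro θ
      rw [← Complex.exp_add]
      ring_nf
    simp_rw [this]
    rw [integral_exp_mul_complex hc, div_eq_zero_iff]
    left
    rw [sub_eq_zero, Complex.exp_eq_exp_iff_exists_int]
    exact ⟨k - m, by push_cast; ring⟩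

theorem integral_mul_exp_neg_of_hasSum_exp {q : ℕ → ℂ} {F : ℝ → ℂ}
    (hq : Summable fun k => ‖q k‖)
    (hF : ∀ θ : ℝ, HasSum (fun k => q k * exp (k * θ * I)) (F θ)) (m : ℕ) :
    ∫ θ in -Real.pi..Real.pi, F θ * exp (-(m * θ * I)) = 2 * Real.pi * q m := by
  have h1 : HasSum
      (fun k => ∫ θ in -Real.pi..Real.pi, q k * exp (k * θ * I) * exp (-(m * θ * I)))
      (∫ θ in -Real.pi..Real.pi, F θ * exp (-(m * θ * I))) := by
    refine intervalIntegral.hasSum_integral_of_dominated_convergence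
      (fun k _ => ‖q k‖) (fun k => ?_) (fun k => ?_) ?_ ?_ ?_
    · exact (Continuous.aestronglyMeasurable (by fun_prop))
    · refine Filter.Eventually.of_forall fun θ _ => ?_
      rw [norm_mul, norm_mul, ← neg_mul, ← ofReal_natCast, ← ofReal_natCast, ← ofReal_mul,
        ← ofReal_mul, ← ofReal_neg, norm_exp_ofReal_mul_I, norm_exp_ofReal_mul_I, mul_one, mul_one]
    · exact Filter.Eventually.of_forall fun θ _ => hq
    · simp
    · exact Filter.Eventually.of_forall fun θ _ => (hF θ).mul_right _
  have h2 : HasSum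
      (fun k => ∫ θ in -Real.pi..Real.pi, q k * exp (k * θ * I) * exp (-(m * θ * I)))
      (2 * Real.pi * q m) := by
    have : ∀ k, ∫ θ in -Real.pi..Real.pi, q k * exp (k * θ * I) * exp (-(m * θ * I)) =
        if k = m then 2 * Real.pi * q m else 0 := by
      intro k
      simp_rw [mul_assoc (q k)]
      rw [intervalIntegral.integral_const_mul, integral_exp_natCast_sub]
      split_ifs with h
      · rw [h]; ring
      · ring
    simp_rw [this]
    exact hasSum_ite_eq m _
  exact h1.unique h2

theorem integral_mul_conj_of_hasSum_exp {q : ℕ → ℂ} {F : ℝ → ℂ}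
    (hq : Summable fun k => ‖q k‖)
    (hF : ∀ θ : ℝ, HasSum (fun k => q k * exp (k * θ * I)) (F θ)) (s : Finset ℕ) :
    ∫ θ in -Real.pi..Real.pi, (F θ * starRingEnd ℂ (∑ k ∈ s, q k * exp (k * θ * I))).re =
      2 * Real.pi * ∑ k ∈ s, ‖q k‖ ^ 2 := by
  have hcont := continuous_of_hasSum_exp hq hF
  have h0 : ∫ θ in -Real.pi..Real.pi, F θ * starRingEnd ℂ (∑ k ∈ s, q k * exp (k * θ * I)) =
      ((2 * Real.pi * ∑ k ∈ s, ‖q k‖ ^ 2 : ℝ) : ℂ) := by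
    have : ∀ θ : ℝ, F θ * starRingEnd ℂ (∑ k ∈ s, q k * exp (k * θ * I)) =
        ∑ k ∈ s, starRingEnd ℂ (q k) * (F θ * exp (-(k * θ * I))) := by
      intro θ
      rw [map_sum, mul_sum]
      refine sum_congr rfl fun k _ => ?_
      rw [map_mul, ← exp_conj]
      simp only [map_mul, conj_I, conj_ofReal, map_natCast]
      rw [mul_neg]
      ring
    simp_rw [this]
    rw [intervalIntegral.integral_finsetSum]
    · push_cast
      rw [mul_sum]
      refine sum_congr rfl fun k _ => ?_
      rw [intervalIntegral.integral_const_mul, integral_mul_exp_neg_of_hasSum_exp hq hF,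
        ← conj_mul']
      ring
    · intro k _
      exact Continuous.intervalIntegrable (by fun_prop) _ _
  have h1 := reCLM.intervalIntegral_comp_comm (μ := MeasureTheory.volume)
    (f := fun θ : ℝ => F θ * starRingEnd ℂ (∑ k ∈ s, q k * exp (k * θ * I)))
    (a := -Real.pi) (b := Real.pi) (Continuous.intervalIntegrable (by fun_prop) _ _)
  simpa only [h0, reCLM_apply, ofReal_re] using h1

theorem sum_norm_sq_le_integral_of_hasSum_exp {q : ℕ → ℂ} {F : ℝ → ℂ}
    (hq : Summable fun k => ‖q k‖)
    (hF : ∀ θ : ℝ, HasSum (fun k => q k * exp (k * θ * I)) (F θ)) (s : Finset ℕ) :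
    2 * Real.pi * ∑ k ∈ s, ‖q k‖ ^ 2 ≤ ∫ θ in -Real.pi..Real.pi, ‖F θ‖ ^ 2 := by
  have hcont := continuous_of_hasSum_exp hq hF
  set P : ℝ → ℂ := fun θ => ∑ k ∈ s, q k * exp (k * θ * I) with hP
  have hPcont : Continuous P := by fun_prop
  have h1 := integral_mul_conj_of_hasSum_exp hq hF s
  have h2 : ∫ θ in -Real.pi..Real.pi, (P θ * starRingEnd ℂ (P θ)).re =
      2 * Real.pi * ∑ k ∈ s, ‖q k‖ ^ 2 := by
    have := integral_mul_conj_of_hasSum_exp (q := fun k => if k ∈ s then q k else 0) (F := P) ?_ ?_ s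
    · have hsum : ∀ θ : ℝ, ∑ k ∈ s, (if k ∈ s then q k else 0) * exp (k * θ * I) = P θ :=
        fun θ => sum_congr rfl fun k hk => by rw [if_pos hk]
      have hnorm : ∑ k ∈ s, ‖if k ∈ s then q k else 0‖ ^ 2 = ∑ k ∈ s, ‖q k‖ ^ 2 :=
        sum_congr rfl fun k hk => by rw [if_pos hk]
      simpa only [hsum, hnorm] using this
    · exact summable_of_ne_finset_zero (s := s) (by simp +contextual)
    · intro θ
      have := hasSum_sum_of_ne_finset_zero (L := .unconditional ℕ) (s := s) (f := fun k => (if k ∈ s then q k else 0) * exp (k * θ * I))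
        (by simp +contextual)
      simpa [hP, ite_mul, sum_ite_mem] using this
  have h3 : ∀ θ, 2 * (F θ * starRingEnd ℂ (P θ)).re - (P θ * starRingEnd ℂ (P θ)).re ≤ ‖F θ‖ ^ 2 := by
    intro θ
    have := normSq_nonneg (F θ - P θ)
    rw [normSq_sub] at this
    rw [← normSq_eq_norm_sq, mul_conj (P θ), ofReal_re]
    linarith
  have h4 : ∫ θ in -Real.pi..Real.pi,
      (2 * (F θ * starRingEnd ℂ (P θ)).re - (P θ * starRingEnd ℂ (P θ)).re) ≤
      ∫ θ in -Real.pi..Real.pi, ‖F θ‖ ^ 2 := by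
    refine intervalIntegral.integral_mono_on (by linarith [Real.pi_pos]) ?_ ?_ fun θ _ => h3 θ
    all_goals exact Continuous.intervalIntegrable (by fun_prop) _ _
  rw [intervalIntegral.integral_sub, intervalIntegral.integral_const_mul, h2] at h4
  · simp only [hP] at h4
    rw [h1] at h4
    linarith
  all_goals exact Continuous.intervalIntegrable (by fun_prop) _ _

section Area

open MeasureTheory

theorem det_restrictScalars_toSpanSingleton (c : ℂ) :
    ((ContinuousLinearMap.toSpanSingleton ℂ c).restrictScalars ℝ).det = ‖c‖ ^ 2 := by
  simp [ContinuousLinearMap.det, LinearMap.det_restrictScalars, Algebra.norm_complex_apply,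
    normSq_eq_norm_sq]

/-- The real-linear map `w ↦ w - μ * conj w`. -/
noncomputable def subMulConj (μ : ℂ) : ℂ →ₗ[ℝ] ℂ :=
  LinearMap.id - (LinearMap.mulLeft ℝ μ) ∘ₗ conjAe.toLinearMap

theorem subMulConj_apply (μ w : ℂ) : subMulConj μ w = w - μ * starRingEnd ℂ w := by
  simp [subMulConj]

theorem det_subMulConj (μ : ℂ) : LinearMap.det (subMulConj μ) = 1 - ‖μ‖ ^ 2 := by
  rw [← LinearMap.det_toMatrix basisOneI, Matrix.det_fin_two, ← normSq_eq_norm_sq, normSq_apply]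
  simp [LinearMap.toMatrix_apply, subMulConj_apply]
  ring

open ENNReal in
theorem lintegral_annulus_eq {δ r : ℝ} (hδ : 0 < δ) {F : ℂ → ℝ≥0∞} (hF : Measurable F) :
    ∫⁻ z in {z : ℂ | δ < ‖z‖ ∧ ‖z‖ < r}, F z =
      ∫⁻ s in Set.Ioo δ r, ENNReal.ofReal s *
        ∫⁻ θ in Set.Ioo (-Real.pi) Real.pi, F (s * exp (θ * I)) := by
  have hA : MeasurableSet {z : ℂ | δ < ‖z‖ ∧ ‖z‖ < r} :=
    (measurableSet_lt measurable_const measurable_norm).inter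
      (measurableSet_lt measurable_norm measurable_const)
  have hpol : ∀ p : ℝ × ℝ, Complex.polarCoord.symm p = p.1 * exp (p.2 * I) := by
    intro p
    rw [Complex.polarCoord_symm_apply, exp_mul_I, ofReal_cos, ofReal_sin]
  rw [← lintegral_indicator hA, ← Complex.lintegral_comp_polarCoord_symm]
  have htarget : polarCoord.target = Set.Ioi (0 : ℝ) ×ˢ Set.Ioo (-Real.pi) Real.pi := rfl
  simp_rw [hpol, smul_eq_mul]
  rw [htarget, Measure.volume_eq_prod, setLIntegral_prod]
  · rw [← lintegral_indicator measurableSet_Ioi, ← lintegral_indicator measurableSet_Ioo]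
    congr 1 with s
    by_cases hs : s ∈ Set.Ioo δ r
    · rw [Set.indicator_of_mem hs, Set.indicator_of_mem (Set.mem_Ioi.2 (hδ.trans hs.1)),
        lintegral_const_mul' _ _ ENNReal.ofReal_ne_top]
      congr 2 with θ
      rw [Set.indicator_of_mem]
      simpa [norm_exp_ofReal_mul_I, abs_of_pos (hδ.trans hs.1)] using hs
    · rw [Set.indicator_of_notMem hs]
      by_cases hs0 : s ∈ Set.Ioi (0 : ℝ)
      · rw [Set.indicator_of_mem hs0]
        refine (lintegral_congr fun θ => ?_).trans lintegral_zero
        rw [Set.indicator_of_notMem, mul_zero]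
        simpa [norm_exp_ofReal_mul_I, abs_of_pos hs0.out] using hs
      · rw [Set.indicator_of_notMem hs0]
  · refine Measurable.aemeasurable ?_
    refine Measurable.mul (by fun_prop) ((hF.indicator hA).comp ?_)
    fun_prop

theorem hasSum_sq_mul_deriv_inv_add {b : ℕ → ℂ} {g : ℂ → ℂ}
    (hg : ∀ z ∈ ball (0:ℂ) 1, HasSum (fun k => b k * z ^ k) (g z)) {z : ℂ}
    (hz : z ∈ ball (0:ℂ) 1) (hz0 : z ≠ 0) :
    HasSum (fun k => (if k = 0 then -1 else (k - 1) * b (k - 1)) * z ^ k)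
      (z ^ 2 * deriv (fun z => z⁻¹ + g z) z) := by
  have hd : DifferentiableAt ℂ g z :=
    (differentiableOn_of_hasSum hg).differentiableAt (isOpen_ball.mem_nhds hz)
  rw [deriv_fun_add (differentiableAt_inv hz0) hd, deriv_inv, ← hasSum_nat_add_iff' 2]
  have h := (hasSum_deriv_of_hasSum hg hz).mul_left (z ^ 2)
  have hfun : (fun k : ℕ => z ^ 2 * ((k + 1) * b (k + 1) * z ^ k)) = fun k : ℕ =>
      (if k + 2 = 0 then -1 else ((k + 2 : ℕ) - 1) * b (k + 2 - 1)) * z ^ (k + 2) := by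
    ext k
    rw [if_neg (by omega), show k + 2 - 1 = k + 1 by omega]
    push_cast
    ring
  rw [hfun] at h
  refine (congrArg (HasSum _) ?_).mpr h
  norm_num [sum_range_succ, mul_add, hz0]

theorem le_integral_circle_norm_deriv_inv_add {b : ℕ → ℂ} {g : ℂ → ℂ}
    (hg : ∀ z ∈ ball (0:ℂ) 1, HasSum (fun k => b k * z ^ k) (g z)) {s : ℝ}
    (hs : s ∈ Set.Ioo (0 : ℝ) 1) (S : Finset ℕ) :
    2 * Real.pi * (s⁻¹ ^ 3 + ∑ k ∈ S, k ^ 2 * ‖b k‖ ^ 2 * s ^ (2 * k - 1)) ≤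
      s * ∫ θ in -Real.pi..Real.pi,
        ‖deriv (fun z => z⁻¹ + g z) (s * exp (θ * I))‖ ^ 2 := by
  obtain ⟨hs0, hs1⟩ := hs
  have hmem : ∀ θ : ℝ, (s * exp (θ * I) : ℂ) ∈ ball (0 : ℂ) 1 := by
    intro θ
    simpa [norm_exp_ofReal_mul_I, abs_of_pos hs0] using hs1
  have hne : ∀ θ : ℝ, (s * exp (θ * I) : ℂ) ≠ 0 := fun θ =>
    mul_ne_zero (by exact_mod_cast hs0.ne') (exp_ne_zero _)
  set c : ℕ → ℂ := fun k => if k = 0 then -1 else (k - 1) * b (k - 1) with hc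
  set G : ℂ → ℂ := fun z => z⁻¹ + g z with hG
  have hsum : ∀ θ : ℝ, HasSum (fun k : ℕ => (c k * s ^ k) * exp (k * θ * I))
      ((s * exp (θ * I)) ^ 2 * deriv G (s * exp (θ * I))) := by
    intro θ
    convert hasSum_sq_mul_deriv_inv_add hg (hmem θ) (hne θ) using 2 with k
    simp only [hc]
    rw [mul_pow, ← exp_nat_mul]
    ring_nf
  have hsummable : Summable fun k => ‖c k * s ^ k‖ := by
    simpa using (hsum 0).summable.norm
  have h := sum_norm_sq_le_integral_of_hasSum_exp hsummable hsum
    (insert 0 (S.map ⟨Nat.succ, Nat.succ_injective⟩))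
  rw [sum_insert (by simp), sum_map] at h
  have h1 : ∀ k : ℕ, ‖c (k + 1) * s ^ (k + 1)‖ ^ 2 =
      s ^ 3 * (k ^ 2 * ‖b k‖ ^ 2 * s ^ (2 * k - 1)) := by
    intro k
    simp only [hc, Nat.succ_ne_zero, if_false, Nat.cast_succ, add_sub_cancel_right, norm_mul,
      norm_pow, Complex.norm_natCast, Nat.add_sub_cancel, norm_real, Real.norm_eq_abs, abs_of_pos hs0]
    rcases Nat.eq_zero_or_pos k with rfl | hk
    · simp
    · obtain ⟨j, rfl⟩ : ∃ j, k = j + 1 := ⟨k - 1, by omega⟩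
      rw [show 2 * (j + 1) - 1 = 2 * j + 1 by omega]
      ring
  have h2 : ∀ θ : ℝ, ‖(s * exp (θ * I)) ^ 2 * deriv G (s * exp (θ * I))‖ ^ 2 =
      s ^ 4 * ‖deriv G (s * exp (θ * I))‖ ^ 2 := by
    intro θ
    rw [norm_mul, norm_pow, norm_mul, norm_exp_ofReal_mul_I, norm_real, Real.norm_eq_abs,
      abs_of_pos hs0]
    ring
  simp_rw [h2] at h
  simp only [Function.Embedding.coeFn_mk, Nat.succ_eq_add_one, h1] at h
  rw [intervalIntegral.integral_const_mul, ← mul_sum] at h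
  have h3 : 0 < s ^ 3 := by positivity
  refine le_of_mul_le_mul_left (le_trans (le_of_eq ?_) (h.trans (le_of_eq ?_))) h3
  · simp [hc]
    field_simp
  · ring

theorem le_volume_image_annulus {b : ℕ → ℂ} {g : ℂ → ℂ}
    (hg : ∀ z ∈ ball (0:ℂ) 1, HasSum (fun k => b k * z ^ k) (g z))
    (hinj : Set.InjOn (fun z => z⁻¹ + g z) (ball (0:ℂ) 1 \ {0}))
    {δ r : ℝ} (hδ : 0 < δ) (hδr : δ < r) (hr : r < 1) (S : Finset ℕ) :
    ENNReal.ofReal (Real.pi * (δ⁻¹ ^ 2 - r⁻¹ ^ 2 +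
        ∑ k ∈ S, k * ‖b k‖ ^ 2 * (r ^ (2 * k) - δ ^ (2 * k)))) ≤
      volume ((fun z => z⁻¹ + g z) '' {z : ℂ | δ < ‖z‖ ∧ ‖z‖ < r}) := by
  set G : ℂ → ℂ := fun z => z⁻¹ + g z with hG
  have hA : MeasurableSet {z : ℂ | δ < ‖z‖ ∧ ‖z‖ < r} :=
    (measurableSet_lt measurable_const measurable_norm).inter
      (measurableSet_lt measurable_norm measurable_const)
  have hsub : {z : ℂ | δ < ‖z‖ ∧ ‖z‖ < r} ⊆ ball (0:ℂ) 1 \ {0} := by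
    rintro z ⟨h1, h2⟩
    exact ⟨by simpa using h2.trans hr, norm_pos_iff.1 (hδ.trans h1)⟩
  have hdiff : ∀ z ∈ ball (0:ℂ) 1 \ {0}, DifferentiableAt ℂ G z := by
    rintro z ⟨hz, hz0⟩
    exact (differentiableAt_inv hz0).add
      ((differentiableOn_of_hasSum hg).differentiableAt (isOpen_ball.mem_nhds hz))
  have hGd : DifferentiableOn ℂ G (ball (0:ℂ) 1 \ {0}) := fun z hz =>
    (hdiff z hz).differentiableWithinAt
  have hopen : IsOpen (ball (0:ℂ) 1 \ {0}) := isOpen_ball.sdiff isClosed_singleton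
  have hderiv : ∀ z ∈ {z : ℂ | δ < ‖z‖ ∧ ‖z‖ < r}, HasFDerivWithinAt G
      ((ContinuousLinearMap.toSpanSingleton ℂ (deriv G z)).restrictScalars ℝ)
      {z : ℂ | δ < ‖z‖ ∧ ‖z‖ < r} z := fun z hz =>
    ((hdiff z (hsub hz)).hasDerivAt.hasFDerivAt.restrictScalars ℝ).hasFDerivWithinAt
  rw [← lintegral_abs_det_fderiv_eq_addHaar_image volume hA hderiv (hinj.mono hsub)]
  simp_rw [det_restrictScalars_toSpanSingleton, abs_sq]
  have hmeas : Measurable fun z => ENNReal.ofReal (‖deriv G z‖ ^ 2) :=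
    ((measurable_deriv G).norm.pow_const 2).ennreal_ofReal
  rw [lintegral_annulus_eq hδ hmeas]
  set v : ℝ → ℝ := fun s =>
    2 * Real.pi * (s⁻¹ ^ 3 + ∑ k ∈ S, k ^ 2 * ‖b k‖ ^ 2 * s ^ (2 * k - 1)) with hv
  have hvcont : ContinuousOn v (Set.Icc δ r) := by
    have : ∀ s ∈ Set.Icc δ r, s ≠ 0 := fun s hs => (hδ.trans_le hs.1).ne'
    fun_prop (disch := assumption)
  have hle : ∀ s ∈ Set.Ioo δ r, ENNReal.ofReal (v s) ≤ ENNReal.ofReal s *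
      ∫⁻ θ in Set.Ioo (-Real.pi) Real.pi, ENNReal.ofReal (‖deriv G (s * exp (θ * I))‖ ^ 2) := by
    intro s hs
    have hs0 : 0 < s := hδ.trans hs.1
    have hcont : Continuous fun θ : ℝ => ‖deriv G (s * exp (θ * I))‖ ^ 2 := by
      have h1 : ContinuousOn (deriv G) (ball (0:ℂ) 1 \ {0}) := (hGd.deriv hopen).continuousOn
      refine (h1.comp_continuous (by fun_prop) fun θ => ?_).norm.pow 2
      refine hsub ?_
      simpa [norm_exp_ofReal_mul_I, abs_of_pos hs0] using hs
    rw [← ofReal_integral_eq_lintegral_ofReal, ← ENNReal.ofReal_mul hs0.le]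
    · refine ENNReal.ofReal_le_ofReal ?_
      rw [← integral_Ioc_eq_integral_Ioo,
        ← intervalIntegral.integral_of_le (by linarith [Real.pi_pos])]
      exact le_integral_circle_norm_deriv_inv_add hg ⟨hs0, hs.2.trans hr⟩ S
    · exact (hcont.integrableOn_Icc (a := -Real.pi) (b := Real.pi)).mono_set Set.Ioo_subset_Icc_self
    · exact Filter.Eventually.of_forall fun θ => by positivity
  refine le_trans (le_of_eq ?_) (setLIntegral_mono' measurableSet_Ioo hle)
  rw [← ofReal_integral_eq_lintegral_ofReal, ← integral_Ioc_eq_integral_Ioo,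
    ← intervalIntegral.integral_of_le hδr.le]
  · congr 1
    have hFTC : ∀ s ∈ Set.uIcc δ r, HasDerivAt
        (fun s : ℝ => Real.pi * (-(s⁻¹ ^ 2) + ∑ k ∈ S, k * ‖b k‖ ^ 2 * s ^ (2 * k))) (v s) s := by
      intro s hs
      rw [Set.uIcc_of_le hδr.le] at hs
      have hs0 : s ≠ 0 := (hδ.trans_le hs.1).ne'
      have h1 := ((hasDerivAt_inv hs0).pow 2).neg
      have h2 := HasDerivAt.fun_sum (u := S) fun k _ =>
        (hasDerivAt_pow (2 * k) s).const_mul ((k : ℝ) * ‖b k‖ ^ 2)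
      refine ((h1.add h2).const_mul Real.pi).congr_deriv ?_
      simp only [hv]
      rw [mul_comm 2 Real.pi, mul_assoc Real.pi 2, mul_add 2, mul_sum]
      congr 2
      · norm_num
        field_simp
      · refine sum_congr rfl fun k _ => ?_
        push_cast
        ring
    rw [intervalIntegral.integral_eq_sub_of_hasDerivAt hFTC]
    · rw [← mul_sub]
      congr 1
      simp only [mul_sub, sum_sub_distrib]
      ring
    · exact ContinuousOn.intervalIntegrable (by rwa [Set.uIcc_of_le hδr.le])
  · exact (hvcont.integrableOn_Icc).mono_set Set.Ioo_subset_Icc_self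
  · refine (ae_restrict_iff' measurableSet_Ioo).2 (Filter.Eventually.of_forall fun s hs => ?_)
    have : 0 < s := hδ.trans hs.1
    simp only [hv]
    positivity

theorem exists_norm_sub_le_mul_sq {b : ℕ → ℂ} {g : ℂ → ℂ}
    (hg : ∀ z ∈ ball (0:ℂ) 1, HasSum (fun k => b k * z ^ k) (g z)) (hb0 : b 0 = 0)
    {r : ℝ} (hr : r ∈ Set.Ioo (0 : ℝ) 1) :
    ∃ M, 0 ≤ M ∧ ∀ z : ℂ, ‖z‖ ≤ r → ‖g z - b 1 * z‖ ≤ M * ‖z‖ ^ 2 := by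
  have hrm : (r : ℂ) ∈ ball (0:ℂ) 1 := by simpa [abs_of_pos hr.1] using hr.2
  have hs : Summable fun k => ‖b (k + 2)‖ * r ^ k := by
    have h := ((summable_nat_add_iff 2).2 (hg r hrm).summable.norm).mul_left (r ^ 2)⁻¹
    refine h.congr fun k => ?_
    have := hr.1.ne'
    rw [norm_mul, norm_pow, norm_real, Real.norm_eq_abs, abs_of_pos hr.1]
    field_simp
    ring
  refine ⟨∑' k, ‖b (k + 2)‖ * r ^ k, tsum_nonneg fun k => ?_, fun z hz => ?_⟩
  · have := hr.1.le
    positivity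
  · have h := (hasSum_nat_add_iff' 2).2 (hg z (by simpa using hz.trans_lt hr.2))
    simp only [sum_range_succ, range_zero, sum_empty, zero_add, hb0, zero_mul, pow_one] at h
    rw [← h.tsum_eq]
    refine tsum_of_norm_bounded (hs.hasSum.mul_right _) fun k => ?_
    rw [norm_mul, norm_pow, pow_add, ← mul_assoc]
    gcongr

theorem norm_subMulConj_inv_add_le {B e z : ℂ} {M δ : ℝ} (hδ : 0 < δ) (hM : 0 ≤ M)
    (hδM : δ * (2 * ‖B‖ + 2 * M) ≤ 1) (hz : δ < ‖z‖) (hz1 : ‖z‖ ≤ 1) (he : ‖e‖ ≤ M * ‖z‖ ^ 2) :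
    ‖subMulConj (B * δ ^ 2) (z⁻¹ + (B * z + e))‖ ≤
      δ⁻¹ + (M + ‖B‖ ^ 2 + ‖B‖ * M) * δ ^ 2 := by
  set s := ‖z‖ with hs
  have hs0 : 0 < s := hδ.trans hz
  have hz0 : z ≠ 0 := norm_pos_iff.1 hs0
  have hinv : starRingEnd ℂ z⁻¹ = z * (s ^ 2 : ℝ)⁻¹ := by
    rw [Complex.inv_def, map_mul, conj_conj, conj_ofReal, normSq_eq_norm_sq, ofReal_inv]
  have heq : subMulConj (B * δ ^ 2) (z⁻¹ + (B * z + e)) =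
      z⁻¹ + B * z * ((1 - δ ^ 2 / s ^ 2 : ℝ) : ℂ) + e
        - B * δ ^ 2 * starRingEnd ℂ (B * z + e) := by
    rw [subMulConj_apply, map_add, hinv]
    push_cast
    ring
  have hfac : 0 ≤ 1 - δ ^ 2 / s ^ 2 := by
    rw [sub_nonneg, div_le_one (by positivity)]
    gcongr
  have h1 : ‖B * z + e‖ ≤ ‖B‖ + M := by
    refine (norm_add_le _ _).trans (add_le_add ?_ (he.trans ?_))
    · rw [norm_mul]
      exact mul_le_of_le_one_right (norm_nonneg _) hz1
    · exact mul_le_of_le_one_right hM (pow_le_one₀ hs0.le hz1)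
  have h2 : ‖subMulConj (B * δ ^ 2) (z⁻¹ + (B * z + e))‖ ≤
      s⁻¹ + ‖B‖ * s * (1 - δ ^ 2 / s ^ 2) + M * s ^ 2 + ‖B‖ * δ ^ 2 * (‖B‖ + M) := by
    rw [heq]
    refine (norm_sub_le _ _).trans (add_le_add ((norm_add₃_le).trans (add_le_add_three ?_ ?_ he)) ?_)
    · rw [norm_inv]
    · rw [norm_mul, norm_mul, norm_real, Real.norm_eq_abs, abs_of_nonneg hfac]
    · rw [norm_mul, norm_mul, norm_pow, norm_real, Real.norm_eq_abs, abs_of_pos hδ, RCLike.norm_conj]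
      gcongr
  have h3 : s * (1 - δ ^ 2 / s ^ 2) ≤ 2 * (s - δ) := by
    have : s * (1 - δ ^ 2 / s ^ 2) = (s - δ) * ((s + δ) / s) := by
      field_simp
      ring
    rw [this, mul_comm]
    have h0 : 0 ≤ s - δ := sub_nonneg.2 hz.le
    gcongr
    rw [div_le_iff₀ hs0]
    linarith
  have h4 : M * s ^ 2 ≤ M * δ ^ 2 + 2 * M * (s - δ) := by
    nlinarith [mul_nonneg hM (mul_nonneg (sub_nonneg.2 hz.le) (by linarith : 0 ≤ 2 - (s + δ)))]
  have h5 : s⁻¹ + (2 * ‖B‖ + 2 * M) * (s - δ) ≤ δ⁻¹ := by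
    have h6 : δ⁻¹ - s⁻¹ = (s - δ) * (s⁻¹ * δ⁻¹) := by
      field_simp
    have h7 : 2 * ‖B‖ + 2 * M ≤ s⁻¹ * δ⁻¹ := by
      have : 2 * ‖B‖ + 2 * M ≤ δ⁻¹ := by
        rw [← one_div, le_div_iff₀ hδ]
        linarith
      refine this.trans (le_mul_of_one_le_left (by positivity) ((one_le_inv₀ hs0).2 hz1))
    nlinarith [mul_le_mul_of_nonneg_left h7 (sub_nonneg.2 hz.le)]
  nlinarith [mul_le_mul_of_nonneg_left h3 (norm_nonneg B)]

theorem one_sub_mul_le_of_injOn_inv_add {b : ℕ → ℂ} {g : ℂ → ℂ}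
    (hg : ∀ z ∈ ball (0:ℂ) 1, HasSum (fun k => b k * z ^ k) (g z))
    (hinj : Set.InjOn (fun z => z⁻¹ + g z) (ball (0:ℂ) 1 \ {0}))
    {r δ M : ℝ} (hM : 0 ≤ M) (hr : r < 1) (hδ : 0 < δ) (hδr : δ < r)
    (hgM : ∀ z : ℂ, ‖z‖ ≤ r → ‖g z - b 1 * z‖ ≤ M * ‖z‖ ^ 2)
    (hδM : δ * (2 * ‖b 1‖ + 2 * M) ≤ 1) (S : Finset ℕ) :
    (1 - ‖b 1‖ ^ 2 * δ ^ 4) * (δ⁻¹ ^ 2 - r⁻¹ ^ 2 +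
        ∑ k ∈ S, k * ‖b k‖ ^ 2 * (r ^ (2 * k) - δ ^ (2 * k))) ≤
      (δ⁻¹ + (M + ‖b 1‖ ^ 2 + ‖b 1‖ * M) * δ ^ 2) ^ 2 := by
  set G : ℂ → ℂ := fun z => z⁻¹ + g z with hG
  set A : Set ℂ := {z : ℂ | δ < ‖z‖ ∧ ‖z‖ < r} with hA
  set R := δ⁻¹ + (M + ‖b 1‖ ^ 2 + ‖b 1‖ * M) * δ ^ 2 with hR
  have hR0 : 0 ≤ R := by positivity
  have hsub : subMulConj (b 1 * δ ^ 2) '' (G '' A) ⊆ closedBall 0 R := by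
    rintro _ ⟨_, ⟨z, ⟨hz1, hz2⟩, rfl⟩, rfl⟩
    have := norm_subMulConj_inv_add_le hδ hM hδM hz1 (hz2.trans hr).le (hgM z hz2.le)
    rw [add_sub_cancel] at this
    simpa [hG] using this
  have hvol := measure_mono (μ := volume) hsub
  rw [Measure.addHaar_image_linearMap, det_subMulConj, Complex.volume_closedBall] at hvol
  have h1 := le_volume_image_annulus hg hinj hδ hδr hr S
  have hdet : ‖b 1 * (δ : ℂ) ^ 2‖ ^ 2 = ‖b 1‖ ^ 2 * δ ^ 4 := by
    rw [norm_mul, norm_pow, norm_real, Real.norm_eq_abs, abs_of_pos hδ]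
    ring
  rw [hdet] at hvol
  have h2 := (mul_le_mul_right h1 (ENNReal.ofReal |1 - ‖b 1‖ ^ 2 * δ ^ 4|)).trans hvol
  have hnn : 0 ≤ 1 - ‖b 1‖ ^ 2 * δ ^ 4 := by
    have hB : δ * ‖b 1‖ ≤ 1 := by nlinarith [norm_nonneg (b 1)]
    have hB2 : (δ * ‖b 1‖) ^ 2 ≤ 1 := pow_le_one₀ (by positivity) hB
    have hd : δ ^ 2 ≤ 1 := pow_le_one₀ hδ.le (by linarith)
    nlinarith [mul_le_mul hB2 hd (by positivity) zero_le_one]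
  rw [← ENNReal.ofReal_mul (abs_nonneg _), abs_of_nonneg hnn, ← ENNReal.ofReal_pow hR0,
    show (NNReal.pi : ENNReal) = ENNReal.ofReal Real.pi from ?_,
    ← ENNReal.ofReal_mul (by positivity), ENNReal.ofReal_le_ofReal_iff (by positivity)] at h2
  · refine le_of_mul_le_mul_left (le_trans (le_of_eq ?_) (h2.trans (le_of_eq (mul_comm _ _))))
      Real.pi_pos
    ring
  · rw [← NNReal.coe_real_pi, ENNReal.ofReal_coe_nnreal]

theorem area_theorem {b : ℕ → ℂ} {g : ℂ → ℂ}
    (hg : ∀ z ∈ ball (0:ℂ) 1, HasSum (fun k => b k * z ^ k) (g z)) (hb0 : b 0 = 0)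
    (hinj : Set.InjOn (fun z => z⁻¹ + g z) (ball (0:ℂ) 1 \ {0})) (S : Finset ℕ) :
    ∑ k ∈ S, k * ‖b k‖ ^ 2 ≤ 1 := by
  have key : ∀ r ∈ Set.Ioo (0 : ℝ) 1, ∑ k ∈ S, k * ‖b k‖ ^ 2 * r ^ (2 * k) ≤ r⁻¹ ^ 2 := by
    intro r hr
    obtain ⟨M, hM, hgM⟩ := exists_norm_sub_le_mul_sq hg hb0 hr
    set C := M + ‖b 1‖ ^ 2 + ‖b 1‖ * M with hC
    have hev : ∀ᶠ δ : ℝ in nhdsWithin 0 (Set.Ioi 0),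
        (1 - ‖b 1‖ ^ 2 * δ ^ 4) * (-r⁻¹ ^ 2 +
          ∑ k ∈ S, k * ‖b k‖ ^ 2 * (r ^ (2 * k) - δ ^ (2 * k))) ≤
        2 * C * δ + C ^ 2 * δ ^ 4 + ‖b 1‖ ^ 2 * δ ^ 2 := by
      have h1 : ∀ᶠ δ : ℝ in nhdsWithin 0 (Set.Ioi 0), δ < r :=
        nhdsWithin_le_nhds (eventually_lt_nhds hr.1)
      have h2 : ∀ᶠ δ : ℝ in nhdsWithin 0 (Set.Ioi 0), δ * (2 * ‖b 1‖ + 2 * M) < 1 := by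
        refine nhdsWithin_le_nhds (ContinuousAt.eventually_lt (by fun_prop) (by fun_prop) ?_)
        simp
      filter_upwards [h1, h2, self_mem_nhdsWithin] with δ h1 h2 h3
      have hδ : 0 < δ := h3
      have h := one_sub_mul_le_of_injOn_inv_add hg hinj hM hr.2 hδ h1 hgM h2.le S
      rw [← hC] at h
      have e1 : (δ⁻¹ + C * δ ^ 2) ^ 2 = δ⁻¹ ^ 2 + 2 * C * δ + C ^ 2 * δ ^ 4 := by
        field_simp
        ring
      have e2 : ‖b 1‖ ^ 2 * δ ^ 4 * δ⁻¹ ^ 2 = ‖b 1‖ ^ 2 * δ ^ 2 := by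
        field_simp
      rw [e1] at h
      linear_combination h + e2
    have hlim := le_of_tendsto_of_tendsto
      (((by fun_prop : Continuous fun δ : ℝ => (1 - ‖b 1‖ ^ 2 * δ ^ 4) * (-r⁻¹ ^ 2 +
          ∑ k ∈ S, k * ‖b k‖ ^ 2 * (r ^ (2 * k) - δ ^ (2 * k)))).tendsto 0).mono_left
            nhdsWithin_le_nhds)
      (((by fun_prop : Continuous fun δ : ℝ =>
        2 * C * δ + C ^ 2 * δ ^ 4 + ‖b 1‖ ^ 2 * δ ^ 2).tendsto 0).mono_left nhdsWithin_le_nhds)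
      hev
    have hz : ∀ k ∈ S, k * ‖b k‖ ^ 2 * (r ^ (2 * k) - 0 ^ (2 * k)) =
        k * ‖b k‖ ^ 2 * r ^ (2 * k) := by
      intro k _
      rcases eq_or_ne k 0 with rfl | hk
      · simp
      · simp [hk]
    rw [sum_congr rfl hz] at hlim
    norm_num at hlim
    simpa using hlim
  have hlim := le_of_tendsto_of_tendsto (b := nhdsWithin (1 : ℝ) (Set.Iio 1))
    (((by fun_prop : Continuous fun r : ℝ => ∑ k ∈ S, k * ‖b k‖ ^ 2 * r ^ (2 * k)).tendsto 1).mono_left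
      nhdsWithin_le_nhds)
    (((continuousAt_inv₀ (one_ne_zero (α := ℝ))).pow 2).tendsto.mono_left nhdsWithin_le_nhds) (by
      filter_upwards [Ioo_mem_nhdsLT (zero_lt_one' ℝ)] with r hr using key r hr)
  simpa using hlim

end Area

theorem coeff_eq_zero_of_odd {f : ℂ → ℂ} {a : ℕ → ℂ}
    (hf : ∀ z ∈ ball (0:ℂ) 1, HasSum (fun k => a k * z ^ k) (f z))
    (hodd : ∀ z ∈ ball (0:ℂ) 1, f (-z) = -f z) (m : ℕ) : a (2 * m) = 0 := by
  have h : a = fun k => -((-1) ^ k * a k) := by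
    refine coeff_eq_of_hasSum hf fun z hz => ?_
    have h1 := (hf (-z) (by simpa using hz)).neg
    rw [hodd z hz, neg_neg] at h1
    refine h1.congr_fun ?_
    intro k
    rw [neg_pow]
    ring
  have := congrFun h (2 * m)
  simp only [pow_mul, neg_one_sq, one_pow, one_mul] at this
  exact self_eq_neg.1 this

theorem hasSum_odd_of_odd {f : ℂ → ℂ} {a : ℕ → ℂ}
    (hf : ∀ z ∈ ball (0:ℂ) 1, HasSum (fun k => a k * z ^ k) (f z))
    (hodd : ∀ z ∈ ball (0:ℂ) 1, f (-z) = -f z) {z : ℂ} (hz : z ∈ ball (0:ℂ) 1) :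
    HasSum (fun m => a (2 * m + 1) * z ^ (2 * m + 1)) (f z) := by
  have hi : Function.Injective fun m : ℕ => 2 * m + 1 := fun m n h => by
    simpa using h
  refine (hi.hasSum_iff fun k hk => ?_).2 (hf z hz)
  rcases Nat.even_or_odd' k with ⟨m, rfl | rfl⟩
  · rw [coeff_eq_zero_of_odd hf hodd, zero_mul]
  · exact absurd ⟨m, rfl⟩ hk

theorem exists_sq_eq_of_mem_ball {u : ℂ} (hu : u ∈ ball (0:ℂ) 1) :
    ∃ z ∈ ball (0:ℂ) 1, z ^ 2 = u := by
  obtain ⟨z, rfl⟩ := IsAlgClosed.exists_pow_nat_eq u two_pos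
  refine ⟨z, ?_, rfl⟩
  simpa [sq_lt_one_iff_abs_lt_one] using hu

theorem exists_hasSum_of_odd {f : ℂ → ℂ} {a : ℕ → ℂ}
    (hf : ∀ z ∈ ball (0:ℂ) 1, HasSum (fun k => a k * z ^ k) (f z))
    (hodd : ∀ z ∈ ball (0:ℂ) 1, f (-z) = -f z) :
    ∃ C : ℂ → ℂ, (∀ u ∈ ball (0:ℂ) 1, HasSum (fun m => a (2 * m + 1) * u ^ m) (C u)) ∧
      ∀ z ∈ ball (0:ℂ) 1, f z = z * C (z ^ 2) := by
  have hs : ∀ u ∈ ball (0:ℂ) 1, HasSum (fun m => a (2 * m + 1) * u ^ m)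
      (∑' m, a (2 * m + 1) * u ^ m) := by
    intro u hu
    refine Summable.hasSum ?_
    rcases eq_or_ne u 0 with rfl | hu0
    · refine summable_of_ne_finset_zero (s := {0}) fun m hm => ?_
      rw [zero_pow (by simpa using hm), mul_zero]
    · obtain ⟨z, hz, rfl⟩ := exists_sq_eq_of_mem_ball hu
      have hz0 : z ≠ 0 := by
        rintro rfl
        simp at hu0
      refine ((hasSum_odd_of_odd hf hodd hz).summable.mul_left z⁻¹).congr fun m => ?_
      rw [pow_succ, ← pow_mul]
      field_simp
  refine ⟨fun u => ∑' m, a (2 * m + 1) * u ^ m, hs, fun z hz => ?_⟩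
  have hz2 : z ^ 2 ∈ ball (0:ℂ) 1 := by
    have : ‖z‖ < 1 := by simpa using hz
    simpa [norm_pow] using pow_lt_one₀ (norm_nonneg z) this two_ne_zero
  refine (hasSum_odd_of_odd hf hodd hz).unique (((hs _ hz2).mul_left z).congr_fun fun m => ?_)
  ring

theorem sum_antidiagonal_eq_zero_of_mul_eq_one {b c : ℕ → ℂ} {g C : ℂ → ℂ}
    (hg : ∀ u ∈ ball (0:ℂ) 1, HasSum (fun k => b k * u ^ k) (g u))
    (hC : ∀ u ∈ ball (0:ℂ) 1, HasSum (fun k => c k * u ^ k) (C u))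
    (h : ∀ u ∈ ball (0:ℂ) 1, g u * C u = 1) (m : ℕ) :
    ∑ p ∈ antidiagonal m, b p.1 * c p.2 = if m = 0 then 1 else 0 := by
  have h1 : ∀ u ∈ ball (0:ℂ) 1,
      HasSum (fun k => (∑ p ∈ antidiagonal k, b p.1 * c p.2) * u ^ k) 1 := by
    intro u hu
    rw [← h u hu, ← (hg u hu).tsum_eq, ← (hC u hu).tsum_eq,
      tsum_mul_tsum_eq_tsum_sum_antidiagonal_of_summable_norm (hg u hu).summable.norm
        (hC u hu).summable.norm]
    have h2 := (summable_norm_sum_mul_antidiagonal_of_summable_norm (hg u hu).summable.norm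
      (hC u hu).summable.norm).of_norm.hasSum
    refine h2.congr_fun fun k => ?_
    rw [sum_mul]
    refine sum_congr rfl fun p hp => ?_
    rw [← mem_antidiagonal.1 hp, pow_add]
    ring
  refine congrFun (coeff_eq_of_hasSum (b := fun m => if m = 0 then 1 else 0) h1 fun u _ => ?_) m
  have h2 := hasSum_single (f := fun k : ℕ => (if k = 0 then 1 else 0) * u ^ k) 0 fun k hk => by
    simp [hk]
  simpa using h2

theorem exists_reciprocal_coeffs {f : ℂ → ℂ} {a : ℕ → ℂ} (ha1 : a 1 = 1)
    (hf : ∀ z ∈ ball (0:ℂ) 1, HasSum (fun k => a k * z ^ k) (f z))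
    (hinj : Set.InjOn f (ball (0:ℂ) 1))
    (hodd : ∀ z ∈ ball (0:ℂ) 1, f (-z) = -f z) :
    ∃ (β : ℕ → ℂ) (h : ℂ → ℂ), β 0 = 1 ∧
      (∀ m, ∑ p ∈ antidiagonal m, β p.1 * a (2 * p.2 + 1) = if m = 0 then 1 else 0) ∧
      (∀ u ∈ ball (0:ℂ) 1, HasSum (fun k => β k * u ^ k) (h u)) ∧
      (∀ z ∈ ball (0:ℂ) 1, f z * h (z ^ 2) = z) ∧
      ∀ N, ∑ k ∈ range N, (2 * k + 1) * ‖β (k + 1)‖ ^ 2 ≤ 1 := by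
  obtain ⟨C, hC, hfC⟩ := exists_hasSum_of_odd hf hodd
  have hC0 : C 0 = 1 := by
    have h2 := hasSum_single (f := fun k : ℕ => a (2 * k + 1) * (0 : ℂ) ^ k) 0 fun k hk => by
      simp [hk]
    exact (hC 0 (by simp)).unique (by simpa [ha1] using h2)
  have h0 : f 0 = 0 := by rw [hfC 0 (by simp), zero_mul]
  have hne : ∀ u ∈ ball (0:ℂ) 1, C u ≠ 0 := by
    intro u hu hCu
    obtain ⟨z, hz, rfl⟩ := exists_sq_eq_of_mem_ball hu
    have hz0 : z = 0 := hinj hz (by simp) (by rw [h0, hfC z hz, hCu, mul_zero])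
    subst hz0
    simp [hC0] at hCu
  have hd : DifferentiableOn ℂ (fun u => (C u)⁻¹) (ball 0 1) :=
    (differentiableOn_of_hasSum hC).inv hne
  obtain ⟨β, hβ⟩ := exists_hasSum_of_differentiableOn hd
  have hsq : ∀ z ∈ ball (0:ℂ) 1, z ^ 2 ∈ ball (0:ℂ) 1 := by
    intro z hz
    have : ‖z‖ < 1 := by simpa using hz
    simpa [norm_pow] using pow_lt_one₀ (norm_nonneg z) this two_ne_zero
  have hanti := sum_antidiagonal_eq_zero_of_mul_eq_one hβ hC
    fun u hu => inv_mul_cancel₀ (hne u hu)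
  have hβ0 : β 0 = 1 := by simpa [ha1] using hanti 0
  refine ⟨β, fun u => (C u)⁻¹, hβ0, hanti, hβ, fun z hz => ?_, fun N => ?_⟩
  · rw [hfC z hz, mul_assoc, mul_inv_cancel₀ (hne _ (hsq z hz)), mul_one]
  · set b : ℕ → ℂ := fun k => if Odd k then β ((k + 1) / 2) else 0 with hb
    have hbo : ∀ m, b (2 * m + 1) = β (m + 1) := by
      intro m
      simp only [hb]
      rw [if_pos ⟨m, rfl⟩]
      congr 1
      omega
    have hi : Function.Injective fun m : ℕ => 2 * m + 1 := fun m n h => by simpa using h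
    set g : ℂ → ℂ := fun z => if z = 0 then 0 else (f z)⁻¹ - z⁻¹ with hg
    have hgsum : ∀ z ∈ ball (0:ℂ) 1, HasSum (fun k => b k * z ^ k) (g z) := by
      intro z hz
      refine (hi.hasSum_iff fun k hk => ?_).1 ?_
      · rw [hb]
        simp only
        rw [if_neg, zero_mul]
        rintro ⟨m, rfl⟩
        exact hk ⟨m, rfl⟩
      · simp only [Function.comp_def, hbo]
        rcases eq_or_ne z 0 with rfl | hz0
        · simp [hg]
        · have h1 := ((hasSum_nat_add_iff' 1).2 (hβ _ (hsq z hz))).mul_left z⁻¹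
          simp only [hg, if_neg hz0]
          have hv : (f z)⁻¹ - z⁻¹ = z⁻¹ * ((C (z ^ 2))⁻¹ - ∑ i ∈ range 1, β i * (z ^ 2) ^ i) := by
            rw [hfC z hz, mul_inv]
            simp [hβ0]
            ring
          rw [hv]
          refine h1.congr_fun fun m => ?_
          field_simp
          ring
    have hginj : Set.InjOn (fun z => z⁻¹ + g z) (ball (0:ℂ) 1 \ {0}) := by
      rintro z ⟨hz, hz0⟩ w ⟨hw, hw0⟩ h
      refine hinj hz hw ?_
      have hz0' : z ≠ 0 := hz0
      have hw0' : w ≠ 0 := hw0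
      simpa [hg, hz0', hw0'] using h
    have := area_theorem hgsum (by simp [hb]) hginj ((range N).map ⟨_, hi⟩)
    rw [sum_map] at this
    simpa [hbo] using this

theorem sum_range_eq_sum_odd {a : ℕ → ℂ} (ha : ∀ m, a (2 * m) = 0) (n : ℕ) (z : ℂ) :
    ∑ k ∈ range n, a k * z ^ k = ∑ m ∈ range (n / 2), a (2 * m + 1) * z ^ (2 * m + 1) := by
  have h : ∀ M, ∑ k ∈ range (2 * M), a k * z ^ k =
      ∑ m ∈ range M, a (2 * m + 1) * z ^ (2 * m + 1) := by
    intro M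
    induction M with
    | zero => simp
    | succ M ih =>
      rw [show 2 * (M + 1) = 2 * M + 1 + 1 by ring, sum_range_succ, sum_range_succ, ih,
        sum_range_succ, ha, zero_mul, add_zero]
  rcases Nat.even_or_odd' n with ⟨M, rfl | rfl⟩
  · rw [h]
    congr 2
    omega
  · rw [sum_range_succ, h, ha, zero_mul, add_zero]
    congr 2
    omega

theorem norm_le_of_hasSum_of_sum_norm_le {t : ℕ → ℂ} {S : ℂ} {K : ℝ} (h : HasSum t S)
    (hK : ∀ n, ∑ i ∈ range n, ‖t i‖ ≤ K) : ‖S‖ ≤ K :=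
  le_of_tendsto' h.tendsto_sum_nat.norm fun n => (norm_sum_le _ _).trans (hK n)

theorem mul_le_half_sq_add_sq_div {p q L : ℝ} (hL : 0 < L) :
    p * q ≤ (L * p ^ 2 + q ^ 2 / L) / 2 := by
  have h : 0 ≤ (L * p - q) ^ 2 / L := by positivity
  have : (L * p - q) ^ 2 / L = L * p ^ 2 - 2 * (p * q) + q ^ 2 / L := by
    field_simp
    ring
  linarith

theorem norm_geom_sum₂_le {z w : ℂ} {t : ℝ} (hz : ‖z‖ ≤ t) (hw : ‖w‖ ≤ t) (m : ℕ) :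
    ‖∑ i ∈ range (2 * m + 1), z ^ i * w ^ (2 * m - i)‖ ≤ (2 * m + 1) * (t ^ 2) ^ m := by
  have ht : 0 ≤ t := (norm_nonneg z).trans hz
  refine (norm_sum_le _ _).trans ?_
  have h : ∀ i ∈ range (2 * m + 1), ‖z ^ i * w ^ (2 * m - i)‖ ≤ (t ^ 2) ^ m := by
    intro i hi
    have hi' := mem_range.1 hi
    rw [norm_mul, norm_pow, norm_pow, ← pow_mul,
      show t ^ (2 * m) = t ^ i * t ^ (2 * m - i) by rw [← pow_add]; congr 1; omega]
    gcongr
  refine (sum_le_card_nsmul _ _ _ h).trans (le_of_eq ?_)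
  simp

theorem norm_pow_sub_pow_le {z w : ℂ} {t : ℝ} (hz : ‖z‖ ≤ t) (hw : ‖w‖ ≤ t) (m : ℕ) :
    ‖z ^ (2 * m + 1) - w ^ (2 * m + 1)‖ ≤ (2 * m + 1) * (t ^ 2) ^ m * ‖z - w‖ := by
  rw [← Commute.geom_sum₂_mul (Commute.all z w), norm_mul]
  gcongr
  exact norm_geom_sum₂_le hz hw m

section Estimates

variable {β c : ℕ → ℂ}

theorem sum_mul_norm_le_two_fifths
    (hβ : ∀ N, ∑ k ∈ range N, (2 * k + 1) * ‖β (k + 1)‖ ^ 2 ≤ 1) (n : ℕ) :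
    ∑ k ∈ range n, (2 * k + 1) * ‖β (k + 1)‖ * (1 / 3) ^ (k + 1) ≤ 2 / 5 := by
  have h1 : ∀ n : ℕ, ∑ k ∈ range n, (2 * (k : ℝ) + 1) * ((1 / 3 : ℝ) ^ (k + 1)) ^ 2 =
      10 / 64 - ((n : ℝ) / 4 + 10 / 64) * (1 / 9) ^ n := by
    intro n
    induction n with
    | zero => norm_num
    | succ n ih =>
      rw [sum_range_succ, ih, ← pow_mul, mul_comm (n + 1) 2, pow_mul]
      push_cast
      norm_num [pow_succ]
      ring
  have h2 : ∑ k ∈ range n, (2 * k + 1) * ‖β (k + 1)‖ * (1 / 3) ^ (k + 1) ≤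
      (2 / 5 * ∑ k ∈ range n, (2 * k + 1) * ‖β (k + 1)‖ ^ 2 +
        (∑ k ∈ range n, (2 * (k : ℝ) + 1) * ((1 / 3 : ℝ) ^ (k + 1)) ^ 2) / (2 / 5)) / 2 := by
    rw [mul_sum, sum_div, ← sum_add_distrib, sum_div]
    refine sum_le_sum fun k _ => ?_
    have := mul_le_mul_of_nonneg_left (mul_le_half_sq_add_sq_div (p := ‖β (k + 1)‖)
      (q := (1 / 3 : ℝ) ^ (k + 1)) (L := 2 / 5) (by norm_num)) (by positivity : 0 ≤ 2 * (k : ℝ) + 1)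
    linarith
  have h3 : 0 ≤ ((n : ℝ) / 4 + 10 / 64) * (1 / 9) ^ n := by positivity
  have h4 := h1 n
  have h5 := hβ n
  rw [h4] at h2
  linarith

theorem sum_norm_mul_le_one
    (hβ : ∀ N, ∑ k ∈ range N, (2 * k + 1) * ‖β (k + 1)‖ ^ 2 ≤ 1) (n : ℕ) :
    ∑ k ∈ range n, ‖β (k + 1)‖ * (4 / 5) ^ (k + 1) ≤ 1 := by
  have h1 : ∀ n : ℕ, ∑ k ∈ range (n + 2), ((4 / 5 : ℝ) ^ (k + 1)) ^ 2 / (2 * k + 1) ≤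
      1 - 5 / 9 * (16 / 25) ^ (n + 3) := by
    intro n
    induction n with
    | zero => norm_num [sum_range_succ]
    | succ n ih =>
      rw [sum_range_succ]
      have h : ((4 / 5 : ℝ) ^ (n + 2 + 1)) ^ 2 / (2 * (n + 2 : ℕ) + 1) ≤
          (16 / 25) ^ (n + 3) / 5 := by
        rw [← pow_mul, mul_comm _ 2, pow_mul]
        norm_num
        gcongr
        linarith [(Nat.cast_nonneg n : (0 : ℝ) ≤ n)]
      rw [pow_succ _ (n + 3)]
      linarith
  have h2 : ∑ k ∈ range n, ‖β (k + 1)‖ * (4 / 5) ^ (k + 1) ≤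
      (∑ k ∈ range n, (2 * k + 1) * ‖β (k + 1)‖ ^ 2 +
        ∑ k ∈ range n, ((4 / 5 : ℝ) ^ (k + 1)) ^ 2 / (2 * k + 1)) / 2 := by
    rw [← sum_add_distrib, sum_div]
    exact sum_le_sum fun k _ => mul_le_half_sq_add_sq_div (by positivity)
  have h3 : ∑ k ∈ range n, ((4 / 5 : ℝ) ^ (k + 1)) ^ 2 / (2 * k + 1) ≤
      ∑ k ∈ range (n + 2), ((4 / 5 : ℝ) ^ (k + 1)) ^ 2 / (2 * k + 1) :=
    sum_le_sum_of_subset_of_nonneg (range_subset_range.2 (by omega)) fun k _ _ => by positivity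
  have h4 : (0 : ℝ) ≤ 5 / 9 * (16 / 25) ^ (n + 3) := by positivity
  linarith [hβ n, h1 n]

theorem norm_le_pow_of_sum_antidiagonal_eq_zero (hβ0 : β 0 = 1)
    (hc : ∀ m, ∑ p ∈ antidiagonal m, β p.1 * c p.2 = if m = 0 then 1 else 0)
    (hβ : ∀ N, ∑ k ∈ range N, (2 * k + 1) * ‖β (k + 1)‖ ^ 2 ≤ 1) (m : ℕ) :
    ‖c m‖ ≤ (5 / 4) ^ m := by
  induction m using Nat.strong_induction_on with
  | _ m ih =>
    rcases m with _ | m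
    · have := hc 0
      simp [hβ0] at this
      simp [this]
    · have h := hc (m + 1)
      rw [Nat.sum_antidiagonal_eq_sum_range_succ fun i j => β i * c j, sum_range_succ', if_neg
        (Nat.succ_ne_zero m), hβ0, one_mul, Nat.sub_zero] at h
      rw [eq_neg_of_add_eq_zero_right h, norm_neg]
      refine (norm_sum_le _ _).trans ?_
      calc ∑ k ∈ range (m + 1), ‖β (k + 1) * c (m + 1 - (k + 1))‖
          ≤ ∑ k ∈ range (m + 1), (5 / 4) ^ (m + 1) * (‖β (k + 1)‖ * (4 / 5) ^ (k + 1)) := by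
            refine sum_le_sum fun k hk => ?_
            have hk' : k + 1 ≤ m + 1 := mem_range.1 hk
            have h1 := ih (m + 1 - (k + 1)) (by omega)
            have h2 : (5 / 4 : ℝ) ^ (m + 1) * (4 / 5) ^ (k + 1) =
                (5 / 4) ^ (m + 1 - (k + 1)) := by
              obtain ⟨j, hj⟩ := Nat.exists_eq_add_of_le hk'
              rw [hj, Nat.add_sub_cancel_left, pow_add, mul_right_comm, ← mul_pow]
              norm_num
            rw [norm_mul, mul_left_comm, h2]
            gcongr
        _ = (5 / 4) ^ (m + 1) * ∑ k ∈ range (m + 1), ‖β (k + 1)‖ * (4 / 5) ^ (k + 1) := by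
            rw [mul_sum]
        _ ≤ (5 / 4) ^ (m + 1) :=
            mul_le_of_le_one_right (by positivity) (sum_norm_mul_le_one hβ _)

end Estimates

theorem sum_tail_le {K : ℕ} (hK : 5 ≤ K) (n : ℕ) :
    ∑ i ∈ range n, (2 * ((i + K : ℕ) : ℝ) + 1) * (5 / 12) ^ (i + K) ≤ 27 / 100 := by
  set F : ℕ → ℝ := fun m => (24 / 7 * m + 204 / 49) * (5 / 12) ^ m with hF
  have hF0 : ∀ m, 0 ≤ F m := fun m => by positivity
  have hFs : ∀ m : ℕ, (2 * (m : ℝ) + 1) * (5 / 12) ^ m = F m - F (m + 1) := by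
    intro m
    simp only [hF]
    push_cast
    ring
  have hanti : Antitone F := antitone_nat_of_succ_le fun m => by
    have := hFs m
    have : 0 ≤ (2 * (m : ℝ) + 1) * (5 / 12) ^ m := by positivity
    linarith
  have h5 : F 5 ≤ 27 / 100 := by norm_num [hF]
  have h : ∑ i ∈ range n, (2 * ((i + K : ℕ) : ℝ) + 1) * (5 / 12) ^ (i + K) = F K - F (n + K) := by
    induction n with
    | zero => simp
    | succ n ih =>
      rw [sum_range_succ, ih, hFs, show n + 1 + K = n + K + 1 by ring]
      ring
  rw [h]
  exact (sub_le_self _ (hF0 _)).trans ((hanti hK).trans h5)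

theorem ne_of_norm_bounds_two {β δ z w : ℂ} {t : ℝ} (ht : t ^ 2 = 1 / 3)
    (hz : ‖z‖ ≤ t) (hw : ‖w‖ ≤ t) (hβ : ‖β‖ ^ 2 + 3 * ‖δ‖ ^ 2 ≤ 1) :
    1 + -β * (z ^ 2 + z * w + w ^ 2) + (β ^ 2 - δ) * (z ^ 4 + z ^ 3 * w + z ^ 2 * w ^ 2 +
      z * w ^ 3 + w ^ 4) ≠ 0 := by
  intro h
  have hS2 := norm_geom_sum₂_le hz hw 2
  have hS3 := norm_geom_sum₂_le hz hw 3
  rw [ht] at hS2 hS3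
  norm_num [sum_range_succ] at hS2 hS3
  set S2 := w ^ 4 + z * w ^ 3 + z ^ 2 * w ^ 2 + z ^ 3 * w + z ^ 4 with hS2d
  set S3 := w ^ 6 + z * w ^ 5 + z ^ 2 * w ^ 4 + z ^ 3 * w ^ 3 + z ^ 4 * w ^ 2 + z ^ 5 * w + z ^ 6
    with hS3d
  have ht0 : 0 ≤ t := (norm_nonneg z).trans hz
  have hzw : ‖z * w‖ ≤ 1 / 3 := by
    rw [norm_mul, ← ht, sq]
    gcongr
  have hz2 : ‖1 + β * z ^ 2‖ ≤ 1 + ‖β‖ * (1 / 3) := by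
    refine (norm_add_le _ _).trans ?_
    rw [norm_one, norm_mul, norm_pow, ← ht]
    gcongr
  have hw2 : ‖1 + β * w ^ 2‖ ≤ 1 + ‖β‖ * (1 / 3) := by
    refine (norm_add_le _ _).trans ?_
    rw [norm_one, norm_mul, norm_pow, ← ht]
    gcongr
  have key : (1 : ℂ) = β * (z * w) - β ^ 3 * (S3 + β * (z * w) ^ 2 * S2) +
      δ * S2 * ((1 + β * z ^ 2) * (1 + β * w ^ 2)) := by
    rw [hS2d, hS3d]
    linear_combination ((1 + β * z ^ 2) * (1 + β * w ^ 2)) * h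
  have hb := norm_nonneg β
  have hd := norm_nonneg δ
  have hle : (1 : ℝ) ≤ ‖β‖ * (1 / 3) + ‖β‖ ^ 3 * (7 / 27 + ‖β‖ * (1 / 3) ^ 2 * (5 / 9)) +
      ‖δ‖ * (5 / 9) * ((1 + ‖β‖ * (1 / 3)) * (1 + ‖β‖ * (1 / 3))) := by
    calc (1 : ℝ) = ‖(1 : ℂ)‖ := norm_one.symm
      _ ≤ ‖β * (z * w)‖ + ‖β ^ 3 * (S3 + β * (z * w) ^ 2 * S2)‖ +
          ‖δ * S2 * ((1 + β * z ^ 2) * (1 + β * w ^ 2))‖ := by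
        conv_lhs => rw [key]
        exact (norm_add_le _ _).trans (add_le_add_left (norm_sub_le _ _) _)
      _ ≤ _ := by
        gcongr ?_ + ?_ + ?_
        · rw [norm_mul]
          gcongr
        · rw [norm_mul, norm_pow]
          gcongr
          refine (norm_add_le _ _).trans ?_
          rw [norm_mul, norm_mul, norm_pow]
          gcongr
        · rw [norm_mul, norm_mul, norm_mul]
          gcongr
  set b := ‖β‖
  set d := ‖δ‖
  have hb1 : b ≤ 1 := by nlinarith
  have hd1 : d ≤ (23 / 100 + (1 - b ^ 2) / (69 / 100)) / 2 := by
    nlinarith [sq_nonneg (d - 23 / 100)]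
  nlinarith [mul_le_mul_of_nonneg_left hd1 (by positivity : 0 ≤ 5 / 9 * ((1 + b * (1 / 3)) * (1 + b * (1 / 3)))), mul_nonneg hb (sub_nonneg.2 hb1), pow_nonneg hb 2, pow_nonneg hb 3]

theorem ne_of_norm_bounds_three {β δ ε z w : ℂ} {t : ℝ} (ht : t ^ 2 = 1 / 3)
    (hz : ‖z‖ ≤ t) (hw : ‖w‖ ≤ t) (hβ : ‖β‖ ^ 2 + 3 * ‖δ‖ ^ 2 + 5 * ‖ε‖ ^ 2 ≤ 1) :
    1 + -β * (z ^ 2 + z * w + w ^ 2) + (β ^ 2 - δ) * (z ^ 4 + z ^ 3 * w + z ^ 2 * w ^ 2 +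
      z * w ^ 3 + w ^ 4) + (-β ^ 3 + 2 * β * δ - ε) * (z ^ 6 + z ^ 5 * w + z ^ 4 * w ^ 2 +
      z ^ 3 * w ^ 3 + z ^ 2 * w ^ 4 + z * w ^ 5 + w ^ 6) ≠ 0 := by
  intro h
  have hS2 := norm_geom_sum₂_le hz hw 2
  have hS3 := norm_geom_sum₂_le hz hw 3
  have hS4 := norm_geom_sum₂_le hz hw 4
  rw [ht] at hS2 hS3 hS4
  norm_num [sum_range_succ] at hS2 hS3 hS4
  set S2 := w ^ 4 + z * w ^ 3 + z ^ 2 * w ^ 2 + z ^ 3 * w + z ^ 4 with hS2d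
  set S3 := w ^ 6 + z * w ^ 5 + z ^ 2 * w ^ 4 + z ^ 3 * w ^ 3 + z ^ 4 * w ^ 2 + z ^ 5 * w + z ^ 6
    with hS3d
  set S4 := w ^ 8 + z * w ^ 7 + z ^ 2 * w ^ 6 + z ^ 3 * w ^ 5 + z ^ 4 * w ^ 4 + z ^ 5 * w ^ 3 +
    z ^ 6 * w ^ 2 + z ^ 7 * w + z ^ 8 with hS4d
  have ht0 : 0 ≤ t := (norm_nonneg z).trans hz
  have hzw : ‖z * w‖ ≤ 1 / 3 := by
    rw [norm_mul, ← ht, sq]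
    gcongr
  have hz2 : ‖1 + β * z ^ 2‖ ≤ 1 + ‖β‖ * (1 / 3) := by
    refine (norm_add_le _ _).trans ?_
    rw [norm_one, norm_mul, norm_pow, ← ht]
    gcongr
  have hw2 : ‖1 + β * w ^ 2‖ ≤ 1 + ‖β‖ * (1 / 3) := by
    refine (norm_add_le _ _).trans ?_
    rw [norm_one, norm_mul, norm_pow, ← ht]
    gcongr
  have key : (1 : ℂ) = β * (z * w) + β ^ 4 * (S4 + β * (z * w) ^ 2 * S3) +
      (δ * (S2 - 2 * β * S3) + ε * S3) * ((1 + β * z ^ 2) * (1 + β * w ^ 2)) := by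
    rw [hS2d, hS3d, hS4d]
    linear_combination ((1 + β * z ^ 2) * (1 + β * w ^ 2)) * h
  have hb := norm_nonneg β
  have hd := norm_nonneg δ
  have he := norm_nonneg ε
  have hle : (1 : ℝ) ≤ ‖β‖ * (1 / 3) + ‖β‖ ^ 4 * (1 / 9 + ‖β‖ * (1 / 3) ^ 2 * (7 / 27)) +
      (‖δ‖ * (5 / 9 + 2 * ‖β‖ * (7 / 27)) + ‖ε‖ * (7 / 27)) *
        ((1 + ‖β‖ * (1 / 3)) * (1 + ‖β‖ * (1 / 3))) := by
    calc (1 : ℝ) = ‖(1 : ℂ)‖ := norm_one.symm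
      _ ≤ ‖β * (z * w)‖ + ‖β ^ 4 * (S4 + β * (z * w) ^ 2 * S3)‖ +
          ‖(δ * (S2 - 2 * β * S3) + ε * S3) * ((1 + β * z ^ 2) * (1 + β * w ^ 2))‖ := by
        conv_lhs => rw [key]
        exact norm_add₃_le
      _ ≤ _ := by
        gcongr ?_ + ?_ + ?_
        · rw [norm_mul]
          gcongr
        · rw [norm_mul, norm_pow]
          gcongr
          refine (norm_add_le _ _).trans ?_
          rw [norm_mul, norm_mul, norm_pow]
          gcongr
        · rw [norm_mul, norm_mul (1 + β * z ^ 2)]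
          gcongr
          refine (norm_add_le _ _).trans ?_
          rw [norm_mul, norm_mul]
          gcongr
          refine (norm_sub_le _ _).trans ?_
          rw [norm_mul, norm_mul, Complex.norm_ofNat]
          gcongr
  set b := ‖β‖
  set d := ‖δ‖
  set e := ‖ε‖
  have hb1 : b ≤ 1 := by nlinarith
  set u := (1 + b * (1 / 3)) * (1 + b * (1 / 3)) with hu
  have hP : d * ((5 / 9 + 2 * b * (7 / 27)) * u) ≤
      (9 / 2 * d ^ 2 + ((5 / 9 + 2 * b * (7 / 27)) * u) ^ 2 / (9 / 2)) / 2 :=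
    mul_le_half_sq_add_sq_div (by norm_num)
  have hQ : e * (7 / 27 * u) ≤ (15 / 2 * e ^ 2 + (7 / 27 * u) ^ 2 / (15 / 2)) / 2 :=
    mul_le_half_sq_add_sq_div (by norm_num)
  rw [show (d * (5 / 9 + 2 * b * (7 / 27)) + e * (7 / 27)) * u =
    d * ((5 / 9 + 2 * b * (7 / 27)) * u) + e * (7 / 27 * u) by ring] at hle
  have hle2 : 1 ≤ b * (1 / 3) + b ^ 4 * (1 / 9 + b * (1 / 3) ^ 2 * (7 / 27)) +
      3 / 4 * (1 - b ^ 2) + ((5 / 9 + 2 * b * (7 / 27)) * u) ^ 2 / 9 + (7 / 27 * u) ^ 2 / 15 := by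
    linarith
  have hpow : ∀ k, 2 ≤ k → b ^ k ≤ b ^ 2 := fun k hk => pow_le_pow_of_le_one hb hb1 hk
  rw [hu] at hle2
  linarith [hpow 3 (by norm_num), hpow 4 (by norm_num), hpow 5 (by norm_num),
    hpow 6 (by norm_num), sq_nonneg (b - 13 / 20)]

theorem norm_reciprocal_sub_le {β : ℕ → ℂ} {h : ℂ → ℂ} (hβ0 : β 0 = 1)
    (hh : ∀ u ∈ ball (0:ℂ) 1, HasSum (fun k => β k * u ^ k) (h u))
    (hβ : ∀ N, ∑ k ∈ range N, (2 * k + 1) * ‖β (k + 1)‖ ^ 2 ≤ 1)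
    {z w : ℂ} {t : ℝ} (ht : t ^ 2 = 1 / 3) (hz : ‖z‖ ≤ t) (hw : ‖w‖ ≤ t) :
    ‖(z * h (w ^ 2) - w * h (z ^ 2)) - (z - w)‖ ≤ 2 / 5 * ‖z - w‖ := by
  have hmem : ∀ v : ℂ, ‖v‖ ≤ t → v ^ 2 ∈ ball (0:ℂ) 1 := fun v hv => by
    have : ‖v‖ ^ 2 ≤ t ^ 2 := by gcongr
    rw [mem_ball_zero_iff, norm_pow]
    linarith
  have h1 := (hasSum_nat_add_iff' 1).2
    (((hh _ (hmem w hw)).mul_left z).sub ((hh _ (hmem z hz)).mul_left w))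
  simp only [range_one, sum_singleton, hβ0, pow_zero, mul_one] at h1
  refine norm_le_of_hasSum_of_sum_norm_le h1 fun n => ?_
  refine le_trans (sum_le_sum fun k _ => ?_)
    ((sum_mul _ _ _).symm.le.trans
      (mul_le_mul_of_nonneg_right (sum_mul_norm_le_two_fifths hβ n) (norm_nonneg (z - w))))
  have h2 : z * (β (k + 1) * (w ^ 2) ^ (k + 1)) - w * (β (k + 1) * (z ^ 2) ^ (k + 1)) =
      -(β (k + 1) * (z * w) * (z ^ (2 * k + 1) - w ^ (2 * k + 1))) := by
    ring
  have hzw : ‖z * w‖ ≤ 1 / 3 := by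
    have ht0 : 0 ≤ t := (norm_nonneg z).trans hz
    rw [norm_mul, ← ht, sq]
    gcongr
  have h3 := norm_pow_sub_pow_le hz hw k
  rw [ht] at h3
  rw [h2, norm_neg, norm_mul, norm_mul]
  calc ‖β (k + 1)‖ * ‖z * w‖ * ‖z ^ (2 * k + 1) - w ^ (2 * k + 1)‖
      ≤ ‖β (k + 1)‖ * (1 / 3) * ((2 * k + 1) * (1 / 3) ^ k * ‖z - w‖) := by gcongr
    _ = _ := by ring

theorem norm_reciprocal_le {β : ℕ → ℂ} {h : ℂ → ℂ} (hβ0 : β 0 = 1)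
    (hh : ∀ u ∈ ball (0:ℂ) 1, HasSum (fun k => β k * u ^ k) (h u))
    (hβ : ∀ N, ∑ k ∈ range N, (2 * k + 1) * ‖β (k + 1)‖ ^ 2 ≤ 1)
    {u : ℂ} (hu : ‖u‖ ≤ 1 / 3) : ‖h u‖ ≤ 7 / 5 := by
  have h1 := (hasSum_nat_add_iff' 1).2 (hh u (by rw [mem_ball_zero_iff]; linarith))
  simp only [range_one, sum_singleton, hβ0, pow_zero, mul_one] at h1
  have h2 : ‖h u - 1‖ ≤ 2 / 5 := by
    refine norm_le_of_hasSum_of_sum_norm_le h1 fun n => ?_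
    refine le_trans (sum_le_sum fun k _ => ?_) (sum_mul_norm_le_two_fifths hβ n)
    rw [norm_mul, norm_pow]
    have hk : ‖β (k + 1)‖ ≤ (2 * k + 1) * ‖β (k + 1)‖ :=
      le_mul_of_one_le_left (norm_nonneg _) (by linarith [(Nat.cast_nonneg k : (0 : ℝ) ≤ k)])
    gcongr
  calc ‖h u‖ = ‖1 + (h u - 1)‖ := by rw [add_sub_cancel]
    _ ≤ 1 + 2 / 5 := (norm_add_le _ _).trans (by rw [norm_one]; gcongr)
    _ = 7 / 5 := by norm_num

theorem norm_sub_le_of_sum_eq {f : ℂ → ℂ} {c : ℕ → ℂ} {z w : ℂ} {t : ℝ}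
    (ht : t ^ 2 = 1 / 3) (hz : ‖z‖ ≤ t) (hw : ‖w‖ ≤ t) (hc : ∀ m, ‖c m‖ ≤ (5 / 4) ^ m)
    (hfz : HasSum (fun m => c m * z ^ (2 * m + 1)) (f z))
    (hfw : HasSum (fun m => c m * w ^ (2 * m + 1)) (f w)) {K : ℕ} (hK : 5 ≤ K)
    (h : ∑ m ∈ range K, c m * z ^ (2 * m + 1) = ∑ m ∈ range K, c m * w ^ (2 * m + 1)) :
    ‖f z - f w‖ ≤ 27 / 100 * ‖z - w‖ := by
  have h1 := (hasSum_nat_add_iff' K).2 (hfz.sub hfw)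
  rw [sum_sub_distrib, h, sub_self, sub_zero] at h1
  refine norm_le_of_hasSum_of_sum_norm_le h1 fun n => ?_
  refine le_trans (sum_le_sum fun k _ => ?_) ((sum_mul _ _ _).symm.le.trans
      (mul_le_mul_of_nonneg_right (sum_tail_le hK n) (norm_nonneg (z - w))))
  have h3 := norm_pow_sub_pow_le hz hw (k + K)
  rw [ht] at h3
  rw [← mul_sub, norm_mul]
  calc ‖c (k + K)‖ * ‖z ^ (2 * (k + K) + 1) - w ^ (2 * (k + K) + 1)‖
      ≤ (5 / 4) ^ (k + K) * ((2 * (k + K : ℕ) + 1) * (1 / 3) ^ (k + K) * ‖z - w‖) := by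
        gcongr
        exact hc _
    _ = _ := by
        rw [show (5 / 12 : ℝ) = 5 / 4 * (1 / 3) by norm_num, mul_pow]
        ring

/-- The n-th partial sum (n ≥ 2) of an odd univalent normalized analytic function on
the unit disk is injective on the disk of radius 1/√3. -/
theorem partial_sums_of_odd_univalent_injective
    (f : ℂ → ℂ) (a : ℕ → ℂ) (ha0 : a 0 = 0) (ha1 : a 1 = 1)
    (hf : ∀ z ∈ ball (0:ℂ) 1, HasSum (fun k => a k * z ^ k) (f z))
    (hinj : Set.InjOn f (ball (0:ℂ) 1))
    (hodd : ∀ z ∈ ball (0:ℂ) 1, f (-z) = -f z)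
    (n : ℕ) (hn : 2 ≤ n) :
    Set.InjOn (fun z => ∑ k ∈ Finset.range (n+1), a k * z ^ k)
      (ball (0:ℂ) (1 / Real.sqrt 3)) := by
  intro z hz w hw heq
  obtain ⟨β, h, hβ0, hc, hh, hfh, hβ⟩ := exists_reciprocal_coeffs ha1 hf hinj hodd
  have heven := coeff_eq_zero_of_odd hf hodd
  simp only [sum_range_eq_sum_odd heven] at heq
  set t : ℝ := 1 / Real.sqrt 3 with ht_def
  have ht : t ^ 2 = 1 / 3 := by rw [ht_def, div_pow, Real.sq_sqrt (by norm_num), one_pow]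
  have ht0 : 0 < t := by positivity
  have ht1 : t < 1 := by nlinarith
  rw [mem_ball_zero_iff] at hz hw
  by_contra hzw
  have hzw' : z - w ≠ 0 := sub_ne_zero.2 hzw
  have hc1 := hc 1
  have hc2 := hc 2
  have hc3 := hc 3
  simp [Nat.antidiagonal_succ, hβ0, ha1] at hc1 hc2 hc3
  have hβ1 := hβ 1
  have hβ2 := hβ 2
  have hβ3 := hβ 3
  norm_num [sum_range_succ] at hβ1 hβ2 hβ3
  have e3 : a 3 = -β 1 := by linear_combination hc1
  have e5 : a 5 = β 1 ^ 2 - β 2 := by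
    rw [e3] at hc2
    linear_combination hc2
  have e7 : a 7 = -β 1 ^ 3 + 2 * β 1 * β 2 - β 3 := by
    rw [e3, e5] at hc3
    linear_combination hc3
  obtain ⟨K, hK⟩ : ∃ K, (n + 1) / 2 = K := ⟨_, rfl⟩
  rw [hK] at heq
  have hK1 : 1 ≤ K := by omega
  rcases (by omega : K = 1 ∨ K = 2 ∨ K = 3 ∨ K = 4 ∨ 5 ≤ K) with rfl | rfl | rfl | rfl | hK5
  · simp [ha1] at heq
    exact hzw heq
  · simp only [sum_range_succ, range_zero, sum_empty] at heq
    norm_num [ha1, e3] at heq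
    have h1 : 1 = β 1 * (z ^ 2 + z * w + w ^ 2) := by
      refine mul_left_cancel₀ hzw' ?_
      linear_combination heq
    have h2 : ‖β 1 * (z ^ 2 + z * w + w ^ 2)‖ < 1 := by
      have h3 : ‖z ^ 2 + z * w + w ^ 2‖ < 1 := by
        refine norm_add₃_le.trans_lt ?_
        rw [norm_mul, norm_pow, norm_pow]
        nlinarith [norm_nonneg z, norm_nonneg w]
      rw [norm_mul]
      nlinarith [norm_nonneg (β 1), norm_nonneg (z ^ 2 + z * w + w ^ 2)]
    rw [← h1, norm_one] at h2
    exact lt_irrefl _ h2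
  · simp only [sum_range_succ, range_zero, sum_empty] at heq
    norm_num [ha1, e3, e5] at heq
    refine ne_of_norm_bounds_two (β := β 1) (δ := β 2) ht hz.le hw.le (by linarith)
      (mul_left_cancel₀ hzw' ?_)
    linear_combination heq
  · simp only [sum_range_succ, range_zero, sum_empty] at heq
    norm_num [ha1, e3, e5, e7] at heq
    refine ne_of_norm_bounds_three (β := β 1) (δ := β 2) (ε := β 3) ht hz.le hw.le (by linarith)
      (mul_left_cancel₀ hzw' ?_)
    linear_combination heq
  · have hz1 : z ∈ ball (0:ℂ) 1 := mem_ball_zero_iff.2 (hz.trans ht1)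
    have hw1 : w ∈ ball (0:ℂ) 1 := mem_ball_zero_iff.2 (hw.trans ht1)
    have h1 := norm_sub_le_of_sum_eq (c := fun m => a (2 * m + 1)) ht hz.le hw.le
      (norm_le_pow_of_sum_antidiagonal_eq_zero hβ0 hc hβ)
      (hasSum_odd_of_odd hf hodd hz1) (hasSum_odd_of_odd hf hodd hw1) hK5 heq
    have h2 := norm_reciprocal_sub_le hβ0 hh hβ ht hz.le hw.le
    have hsq : ∀ v : ℂ, ‖v‖ < t → ‖v ^ 2‖ ≤ 1 / 3 := fun v hv => by
      rw [norm_pow, ← ht]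
      gcongr
    have h3 := norm_reciprocal_le hβ0 hh hβ (hsq z hz)
    have h4 := norm_reciprocal_le hβ0 hh hβ (hsq w hw)
    have h5 : z * h (w ^ 2) - w * h (z ^ 2) = (f z - f w) * (h (z ^ 2) * h (w ^ 2)) := by
      linear_combination (-h (w ^ 2)) * hfh z hz1 + h (z ^ 2) * hfh w hw1
    have h6 : ‖z * h (w ^ 2) - w * h (z ^ 2)‖ ≤ 27 / 100 * ‖z - w‖ * (7 / 5 * (7 / 5)) := by
      rw [h5, norm_mul, norm_mul]
      gcongr
    have h7 := norm_sub_norm_le (z - w) (z * h (w ^ 2) - w * h (z ^ 2))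
    rw [norm_sub_rev (z - w)] at h7
    have h8 : 0 < ‖z - w‖ := norm_pos_iff.2 hzw'
    linarith
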